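/- Let δ > 0. There exists a constant C > 0 (depending only on δ) such that for every sequence (a_k) of real numbers, limsup_{N→∞} |S_N^δ| ≤ C · limsup_{R→∞} |S̃_R^δ| + C · sup_{k≥0} |a_k|/(k+1)^δ, where the inequality is understood in [0,∞]. -/

import Mathlib

/-- The generalized binomial coefficient `A_k^δ = Γ(k+δ+1)/(Γ(k+1)·Γ(δ+1))`. -/
noncomputable def cesaroA (δ : ℝ) (k : ℕ) : ℝ :=
  Real.Gamma ((k : ℝ) + δ + 1) / (Real.Gamma ((k : ℝ) + 1) * Real.Gamma (δ + 1))

/-- The Cesàro (C,δ) mean `S_N^δ = (1/A_N^δ) Σ_{k=0}^N A_{N-k}^δ a_k`. -/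
noncomputable def cesaroMean (δ : ℝ) (a : ℕ → ℝ) (N : ℕ) : ℝ :=
  (1 / cesaroA δ N) * ∑ k ∈ Finset.range (N + 1), cesaroA δ (N - k) * a k

/-- The Riesz (R,δ) mean `S̃_R^δ = Σ_{k < R} (1 - k/R)^δ a_k`. -/
noncomputable def rieszMean (δ : ℝ) (a : ℕ → ℝ) (R : ℝ) : ℝ :=
  ∑ k ∈ Finset.range ⌈R⌉₊, if (k : ℝ) < R then (1 - (k : ℝ) / R) ^ δ * a k else 0

open Filter Topology Set
open scoped ContDiff

theorem AnalyticAt.exists_eq_mul_of_eq_zero {g : ℝ → ℝ} (hg : AnalyticAt ℝ g 0)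
    (h0 : g 0 = 0) :
    ∃ r : ℝ → ℝ, AnalyticAt ℝ r 0 ∧ (∀ t, g t = t * r t) ∧ r 0 = deriv g 0 := by
  obtain ⟨p, hp⟩ := hg
  refine ⟨dslope g 0, ⟨_, hp.has_fpower_series_dslope_fslope⟩, fun t => ?_, dslope_same g 0⟩
  have := sub_smul_dslope g 0 t
  simp [h0] at this
  exact this.symm

/-- The operator on germs at `0` that corresponds, under `t = 1 / x`, to replacing
`x ^ δ * Q (1 / x)` by `(x + h) ^ δ * Q (1 / (x + h))`. -/
noncomputable def shiftGerm (δ h : ℝ) (Q : ℝ → ℝ) (t : ℝ) : ℝ :=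
  (1 + h * t) ^ δ * Q (t / (1 + h * t))

theorem eventually_one_add_mul_pos (h : ℝ) : ∀ᶠ t : ℝ in 𝓝 0, 0 < 1 + h * t := by
  have : ContinuousAt (fun t : ℝ => 1 + h * t) 0 := by fun_prop
  exact this.eventually_mem (Ioi_mem_nhds (by simp))

theorem tendsto_div_one_add_mul (h : ℝ) :
    Tendsto (fun t : ℝ => t / (1 + h * t)) (𝓝 0) (𝓝 0) := by
  have : ContinuousAt (fun t : ℝ => t / (1 + h * t)) 0 := by
    refine ContinuousAt.div (by fun_prop) (by fun_prop) (by simp)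
  simpa [ContinuousAt] using this

theorem shiftGerm_sub_self (δ h : ℝ) {i : ℕ} {f r : ℝ → ℝ} (hr : AnalyticAt ℝ r 0)
    (hf : ∀ᶠ t in 𝓝 0, f t = t ^ i * r t) :
    ∃ r' : ℝ → ℝ, AnalyticAt ℝ r' 0 ∧ r' 0 = h * (δ - i) * r 0 ∧
      ∀ᶠ t in 𝓝 0, shiftGerm δ h f t - f t = t ^ (i + 1) * r' t := by
  have hden : HasDerivAt (fun t : ℝ => 1 + h * t) h 0 := by
    simpa using ((hasDerivAt_id (0 : ℝ)).const_mul h).const_add 1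
  have hquot : HasDerivAt (fun t : ℝ => t / (1 + h * t)) 1 0 := by
    simpa using (hasDerivAt_id' (0 : ℝ)).fun_div hden (by simp)
  have hpow : HasDerivAt (fun t : ℝ => (1 + h * t) ^ (δ - i)) (h * (δ - i)) 0 := by
    simpa using hden.rpow_const (p := δ - i) (by simp)
  have hcomp : HasDerivAt (fun t : ℝ => r (t / (1 + h * t))) (deriv r 0) 0 := by
    have hr' : HasDerivAt r (deriv r 0) (0 / (1 + h * 0)) := by
      simpa using hr.differentiableAt.hasDerivAt
    simpa [Function.comp_def] using HasDerivAt.comp (0 : ℝ) hr' hquot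
  have hden_an : AnalyticAt ℝ (fun t : ℝ => 1 + h * t) 0 := by fun_prop
  have hquot_an : AnalyticAt ℝ (fun t : ℝ => t / (1 + h * t)) 0 :=
    analyticAt_id.fun_div hden_an (by simp)
  have hpow_an : AnalyticAt ℝ (fun t : ℝ => (1 + h * t) ^ (δ - i)) 0 :=
    (hden_an.contDiffAt.rpow_const_of_ne (n := ω) (by simp)).analyticAt
  have han : AnalyticAt ℝ
      (fun t : ℝ => (1 + h * t) ^ (δ - i) * r (t / (1 + h * t)) - r t) 0 := by
    refine (hpow_an.mul ?_).sub hr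
    exact AnalyticAt.fun_comp (by simpa using hr) hquot_an
  obtain ⟨r', hr', heq, hval⟩ := han.exists_eq_mul_of_eq_zero (by simp)
  refine ⟨r', hr', ?_, ?_⟩
  · rw [hval, ((hpow.fun_mul hcomp).fun_sub hr.differentiableAt.hasDerivAt).deriv]
    simp
  · filter_upwards [hf, (tendsto_div_one_add_mul h).eventually hf,
      eventually_one_add_mul_pos h] with t h1 h2 h3
    rw [shiftGerm, h1, h2, pow_succ, mul_assoc, ← heq, Real.rpow_sub h3, Real.rpow_natCast, div_pow]
    field_simp

/-- The span of the functions `t ↦ (1 - s * t) ^ δ` with `0 ≤ s < ε`. -/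
def powSpan (δ ε : ℝ) : Submodule ℝ (ℝ → ℝ) :=
  Submodule.span ℝ ((fun s t : ℝ => (1 - s * t) ^ δ) '' Ico 0 ε)

theorem one_mem_powSpan (δ : ℝ) {ε : ℝ} (hε : 0 < ε) : (fun _ => 1 : ℝ → ℝ) ∈ powSpan δ ε :=
  Submodule.subset_span ⟨0, ⟨le_rfl, hε⟩, by simp⟩

theorem powSpan_mono (δ : ℝ) {ε ε' : ℝ} (h : ε ≤ ε') : powSpan δ ε ≤ powSpan δ ε' :=
  Submodule.span_mono (image_mono (Ico_subset_Ico_right h))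

theorem shiftGerm_add (δ h : ℝ) (f g : ℝ → ℝ) :
    shiftGerm δ h (f + g) = shiftGerm δ h f + shiftGerm δ h g := by
  ext t
  simp [shiftGerm, mul_add]

theorem shiftGerm_smul (δ h c : ℝ) (f : ℝ → ℝ) :
    shiftGerm δ h (c • f) = c • shiftGerm δ h f := by
  ext t
  simp [shiftGerm]
  ring

theorem shiftGerm_one_sub_mul_rpow (δ h s : ℝ) :
    ∀ᶠ t in 𝓝 0, shiftGerm δ h (fun t => (1 - s * t) ^ δ) t = (1 - (s - h) * t) ^ δ := by
  filter_upwards [eventually_one_add_mul_pos h, eventually_one_add_mul_pos (h - s)] with t h1 h2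
  have h3 : 1 - s * (t / (1 + h * t)) = (1 + (h - s) * t) / (1 + h * t) := by
    rw [eq_div_iff h1.ne', sub_mul, mul_assoc, div_mul_cancel₀ _ h1.ne']
    ring
  rw [shiftGerm, h3, ← Real.mul_rpow h1.le (by positivity), mul_div_cancel₀ _ h1.ne']
  congr 1
  ring

theorem exists_mem_powSpan_eventuallyEq_shiftGerm {δ ε h : ℝ} (hh : 0 ≤ h) {q : ℝ → ℝ}
    (hq : q ∈ powSpan δ ε) :
    ∃ q' ∈ powSpan δ (ε + h), q' =ᶠ[𝓝 0] shiftGerm δ (-h) q := by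
  induction hq using Submodule.span_induction with
  | mem x hx =>
    obtain ⟨s, hs, rfl⟩ := hx
    refine ⟨_, Submodule.subset_span ⟨s + h, ⟨by linarith [hs.1], by linarith [hs.2]⟩, rfl⟩, ?_⟩
    filter_upwards [shiftGerm_one_sub_mul_rpow δ (-h) s] with t ht
    rw [ht, sub_neg_eq_add]
  | zero => exact ⟨0, zero_mem _, .of_eq (by ext; simp [shiftGerm])⟩
  | add x y _ _ hx hy =>
    obtain ⟨x', hx', hxe⟩ := hx
    obtain ⟨y', hy', hye⟩ := hy
    exact ⟨x' + y', add_mem hx' hy', by rw [shiftGerm_add]; exact hxe.add hye⟩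
  | smul c x _ hx =>
    obtain ⟨x', hx', hxe⟩ := hx
    exact ⟨c • x', Submodule.smul_mem _ c hx', by rw [shiftGerm_smul]; exact hxe.const_smul c⟩

theorem exists_mem_powSpan_eventuallyEq_pow_mul {δ : ℝ} (i : ℕ) (hi : ∀ j < i, δ ≠ j) :
    ∀ ε > 0, ∃ q ∈ powSpan δ ε, ∃ r : ℝ → ℝ, AnalyticAt ℝ r 0 ∧ r 0 ≠ 0 ∧
      ∀ᶠ t in 𝓝 0, q t = t ^ i * r t := by
  induction i with
  | zero =>
    exact fun ε hε => ⟨_, one_mem_powSpan δ hε, fun _ => 1, analyticAt_const, one_ne_zero,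
      .of_forall fun t => by simp⟩
  | succ i ih =>
    intro ε hε
    obtain ⟨q, hq, r, hr, hr0, hqr⟩ := ih (fun j hj => hi j (by omega)) (ε / 2) (by positivity)
    obtain ⟨q', hq', hqq'⟩ :=
      exists_mem_powSpan_eventuallyEq_shiftGerm (h := ε / 2) (by positivity) hq
    obtain ⟨r', hr', hr'0, hsub⟩ := shiftGerm_sub_self δ (-(ε / 2)) hr hqr
    rw [add_halves] at hq'
    refine ⟨q' - q, sub_mem hq' (powSpan_mono δ (by linarith) hq), r', hr', ?_, ?_⟩
    · rw [hr'0]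
      exact mul_ne_zero (mul_ne_zero (by simpa using hε.ne') (sub_ne_zero.2 (hi i (by omega)))) hr0
    · filter_upwards [hqq', hsub] with t h1 h2
      rw [← h2, Pi.sub_apply, h1]

/-- The defect of `n ↦ (n + 1) ^ δ * Q (1 / (n + 1))` in the recurrence
`u (n + 1) = (1 + δ / (n + 1)) * u n` satisfied by the Cesàro numbers. -/
noncomputable def recurrenceDefect (δ : ℝ) (Q : ℝ → ℝ) (t : ℝ) : ℝ :=
  shiftGerm δ 1 Q t - (1 + δ * t) * Q t

theorem recurrenceDefect_add (δ : ℝ) (f g : ℝ → ℝ) :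
    recurrenceDefect δ (f + g) = recurrenceDefect δ f + recurrenceDefect δ g := by
  ext t
  simp [recurrenceDefect, shiftGerm_add]
  ring

theorem recurrenceDefect_smul (δ c : ℝ) (f : ℝ → ℝ) :
    recurrenceDefect δ (c • f) = c • recurrenceDefect δ f := by
  ext t
  simp [recurrenceDefect, shiftGerm_smul]
  ring

theorem exists_recurrenceDefect_eq (δ : ℝ) {i : ℕ} {f r : ℝ → ℝ} (hr : AnalyticAt ℝ r 0)
    (hf : ∀ᶠ t in 𝓝 0, f t = t ^ i * r t) :
    ∃ g : ℝ → ℝ, AnalyticAt ℝ g 0 ∧ g 0 = -i * r 0 ∧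
      ∀ᶠ t in 𝓝 0, recurrenceDefect δ f t = t ^ (i + 1) * g t := by
  obtain ⟨r', hr', hr'0, hsub⟩ := shiftGerm_sub_self δ 1 hr hf
  refine ⟨fun t => r' t - δ * r t, hr'.sub (analyticAt_const.mul hr), ?_, ?_⟩
  · simp only [hr'0]
    ring
  · filter_upwards [hf, hsub] with t h1 h2
    rw [recurrenceDefect, mul_sub, ← h2, h1]
    ring

theorem exists_polynomial_recurrenceDefect {d : ℕ} {ε : ℝ} {Q : ℝ → ℝ}
    (hQ : Q ∈ powSpan (d : ℝ) ε) :
    ∃ p : Polynomial ℝ, p.natDegree ≤ d + 1 ∧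
      ∀ᶠ t in 𝓝 0, recurrenceDefect d Q t = p.eval t := by
  induction hQ using Submodule.span_induction with
  | mem x hx =>
    obtain ⟨s, hs, rfl⟩ := hx
    have hlin (c : ℝ) : (1 + Polynomial.C c * Polynomial.X : Polynomial ℝ).natDegree ≤ 1 := by
      compute_degree
    refine ⟨(1 + .C (1 - s) * .X) ^ d - (1 + .C (d : ℝ) * .X) * (1 + .C (-s) * .X) ^ d, ?_, ?_⟩
    · refine (Polynomial.natDegree_sub_le _ _).trans (max_le ?_ ?_)
      · exact (Polynomial.natDegree_pow_le_of_le d (hlin _)).trans (by omega)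
      · exact (Polynomial.natDegree_mul_le_of_le (hlin _)
          (Polynomial.natDegree_pow_le_of_le d (hlin _))).trans (by omega)
    · filter_upwards [shiftGerm_one_sub_mul_rpow d 1 s] with t ht
      rw [recurrenceDefect, ht]
      simp only [Real.rpow_natCast, Polynomial.eval_sub, Polynomial.eval_pow,
        Polynomial.eval_add, Polynomial.eval_mul, Polynomial.eval_one, Polynomial.eval_C,
        Polynomial.eval_X]
      ring
  | zero => exact ⟨0, by simp, .of_forall fun t => by simp [recurrenceDefect, shiftGerm]⟩
  | add x y _ _ hx hy =>
    obtain ⟨p, hp, hpx⟩ := hx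
    obtain ⟨q, hq, hqy⟩ := hy
    refine ⟨p + q, Polynomial.natDegree_add_le_of_degree_le hp hq, ?_⟩
    filter_upwards [hpx, hqy] with t h1 h2
    simp [recurrenceDefect_add, h1, h2]
  | smul c x _ hx =>
    obtain ⟨p, hp, hpx⟩ := hx
    refine ⟨c • p, (Polynomial.natDegree_smul_le c p).trans hp, ?_⟩
    filter_upwards [hpx] with t h1
    simp [recurrenceDefect_smul, h1]

theorem Polynomial.eq_zero_of_eventually_eval_eq_pow_mul {p : Polynomial ℝ} {m : ℕ}
    (hp : p.natDegree < m) {g : ℝ → ℝ} (hg : ContinuousAt g 0)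
    (h : ∀ᶠ t in 𝓝 0, p.eval t = t ^ m * g t) : p = 0 := by
  by_contra hp0
  obtain ⟨q, hpq, hq⟩ := Polynomial.exists_eq_pow_rootMultiplicity_mul_and_not_dvd p hp0 0
  set k := p.rootMultiplicity 0
  have hk : k < m :=
    ((Polynomial.rootMultiplicity_le_rootMultiplicity_of_dvd hp0 dvd_rfl 0).trans
      ((Polynomial.count_roots p).symm.le.trans
        ((Multiset.count_le_card _ _).trans (Polynomial.card_roots' p)))).trans_lt hp
  have hne : ∀ᶠ t in 𝓝[≠] 0, q.eval t = t ^ (m - k) * g t := by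
    filter_upwards [eventually_nhdsWithin_of_eventually_nhds h, self_mem_nhdsWithin] with t ht ht0
    rw [hpq, ← Nat.add_sub_cancel' hk.le, pow_add] at ht
    simp only [Polynomial.eval_mul, Polynomial.eval_pow, map_zero, sub_zero, Polynomial.eval_X,
      mul_assoc] at ht
    simpa using mul_left_cancel₀ (pow_ne_zero k ht0) ht
  have h1 : Tendsto (fun t => q.eval t) (𝓝[≠] 0) (𝓝 (q.eval 0)) :=
    q.continuous.continuousAt.tendsto.mono_left nhdsWithin_le_nhds
  have h2 : Tendsto (fun t : ℝ => t ^ (m - k) * g t) (𝓝[≠] 0) (𝓝 (0 ^ (m - k) * g 0)) :=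
    (((continuous_pow (m - k)).continuousAt.mul hg).tendsto).mono_left nhdsWithin_le_nhds
  have h3 := tendsto_nhds_unique (h1.congr' hne) h2
  rw [zero_pow (by omega), zero_mul] at h3
  exact hq (Polynomial.dvd_iff_isRoot.2 h3)

theorem exists_mem_powSpan_recurrenceDefect_eq {δ : ℝ} (M : ℕ) :
    ∃ Q ∈ powSpan δ 1, ∃ g : ℝ → ℝ, Q 0 = 1 ∧ AnalyticAt ℝ g 0 ∧
      ∀ᶠ t in 𝓝 0, recurrenceDefect δ Q t = t ^ (M + 2) * g t := by
  induction M with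
  | zero =>
    obtain ⟨g, hg, hg0, hdef⟩ := exists_recurrenceDefect_eq δ (i := 0) (f := fun _ => 1)
      (r := fun _ => 1) analyticAt_const (.of_forall fun t => by simp)
    obtain ⟨g', hg', hgg', -⟩ := hg.exists_eq_mul_of_eq_zero (by simp [hg0])
    refine ⟨_, one_mem_powSpan δ one_pos, g', rfl, hg', ?_⟩
    filter_upwards [hdef] with t ht
    rw [ht, hgg']
    ring
  | succ M ih =>
    obtain ⟨Q, hQ, g, hQ0, hg, hdef⟩ := ih
    by_cases hδ : ∀ j < M + 1, δ ≠ j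
    · obtain ⟨q, hq, r, hr, hr0, hqr⟩ :=
        exists_mem_powSpan_eventuallyEq_pow_mul (M + 1) hδ 1 one_pos
      obtain ⟨f, hf, hf0, hfdef⟩ := exists_recurrenceDefect_eq δ hr hqr
      have hf0' : f 0 ≠ 0 := by
        rw [hf0]
        exact mul_ne_zero (neg_ne_zero.2 (by positivity)) hr0
      obtain ⟨g', hg', hgg', -⟩ :=
        (hg.sub (analyticAt_const (v := g 0 / f 0) |>.mul hf)).exists_eq_mul_of_eq_zero
          (by simp [hf0'])
      refine ⟨Q + (-(g 0 / f 0)) • q, add_mem hQ (Submodule.smul_mem _ _ hq), g', ?_, hg', ?_⟩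
      · simp [hQ0, hqr.self_of_nhds]
      · filter_upwards [hdef, hfdef] with t h1 h2
        rw [recurrenceDefect_add, recurrenceDefect_smul, Pi.add_apply, Pi.smul_apply, h1, h2]
        have h3 := hgg' t
        simp only [Pi.sub_apply, Pi.mul_apply] at h3
        rw [smul_eq_mul]
        linear_combination t ^ (M + 2) * h3
    · push Not at hδ
      obtain ⟨d, hd, rfl⟩ := hδ
      obtain ⟨p, hp, hpdef⟩ := exists_polynomial_recurrenceDefect hQ
      have hp0 : p = 0 := p.eq_zero_of_eventually_eval_eq_pow_mul (m := M + 2) (by omega)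
        hg.continuousAt (by filter_upwards [hdef, hpdef] with t h1 h2; rw [← h1, ← h2])
      refine ⟨Q, hQ, fun _ => 0, hQ0, analyticAt_const, ?_⟩
      filter_upwards [hpdef] with t ht
      simp [ht, hp0]

theorem cesaroA_pos {δ : ℝ} (hδ : 0 < δ) (n : ℕ) : 0 < cesaroA δ n :=
  div_pos (Real.Gamma_pos_of_pos (by positivity))
    (mul_pos (Real.Gamma_pos_of_pos (by positivity)) (Real.Gamma_pos_of_pos (by positivity)))

theorem cesaroA_succ {δ : ℝ} (hδ : 0 < δ) (n : ℕ) :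
    cesaroA δ (n + 1) = (1 + δ * (1 / ((n : ℝ) + 1))) * cesaroA δ n := by
  have h1 : Real.Gamma ((n + 1 : ℕ) + δ + 1) = (n + δ + 1) * Real.Gamma (n + δ + 1) := by
    rw [← Real.Gamma_add_one (by positivity)]
    push_cast
    ring_nf
  have h2 : Real.Gamma ((n + 1 : ℕ) + 1) = (n + 1) * Real.Gamma (n + 1) := by
    rw [← Real.Gamma_add_one (by positivity)]
    push_cast
    rfl
  have h3 : Real.Gamma ((n : ℝ) + 1) ≠ 0 := (Real.Gamma_pos_of_pos (by positivity)).ne'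
  have h4 : Real.Gamma (δ + 1) ≠ 0 := (Real.Gamma_pos_of_pos (by positivity)).ne'
  rw [cesaroA, cesaroA, h1, h2]
  field_simp
  ring

theorem rpow_div_cesaroA_eq {δ : ℝ} (hδ : 0 < δ) (n : ℕ) :
    (n : ℝ) ^ δ / cesaroA δ n = δ * Real.GammaSeq δ n := by
  have h (m : ℕ) : cesaroA δ m * (δ * m.factorial) = ∏ j ∈ Finset.range (m + 1), (δ + j) := by
    induction m with
    | zero =>
      have := (Real.Gamma_pos_of_pos (s := δ + 1) (by positivity)).ne'
      simp [cesaroA, this]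
    | succ m ih =>
      rw [Finset.prod_range_succ, ← ih, cesaroA_succ hδ, Nat.factorial_succ]
      push_cast
      field_simp
      ring
  have h1 := (cesaroA_pos hδ n).ne'
  have h2 : (n.factorial : ℝ) ≠ 0 := by positivity
  rw [Real.GammaSeq, ← h]
  field_simp

theorem tendsto_add_one_rpow_div_cesaroA {δ : ℝ} (hδ : 0 < δ) :
    Tendsto (fun n : ℕ => ((n : ℝ) + 1) ^ δ / cesaroA δ n) atTop (𝓝 (Real.Gamma (δ + 1))) := by
  have h1 : Tendsto (fun n : ℕ => (1 + 1 / (n : ℝ)) ^ δ) atTop (𝓝 1) := by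
    have : Tendsto (fun n : ℕ => 1 + 1 / (n : ℝ)) atTop (𝓝 1) := by
      simpa using tendsto_one_div_atTop_nhds_zero_nat (𝕜 := ℝ).const_add 1
    simpa using this.rpow_const (p := δ) (by simp)
  have h2 := h1.mul ((Real.GammaSeq_tendsto_Gamma δ).const_mul δ)
  rw [one_mul, ← Real.Gamma_add_one hδ.ne'] at h2
  refine h2.congr' ?_
  filter_upwards [eventually_gt_atTop 0] with n hn
  have hn' : (0 : ℝ) < n := by exact_mod_cast hn
  rw [← rpow_div_cesaroA_eq hδ, ← mul_div_assoc, ← Real.mul_rpow (by positivity) hn'.le]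
  congr 2
  field_simp

theorem abs_sub_le_of_tendsto_of_abs_sub_succ_le {ρ z : ℕ → ℝ} {L : ℝ} {N : ℕ}
    (hρ : Tendsto ρ atTop (𝓝 L)) (hz : ∀ n, 0 ≤ z n)
    (h : ∀ n ≥ N, |ρ (n + 1) - ρ n| ≤ z n - z (n + 1)) {n : ℕ} (hn : N ≤ n) :
    |L - ρ n| ≤ z n := by
  have key (m : ℕ) (hm : n ≤ m) : |ρ m - ρ n| ≤ z n - z m := by
    induction m, hm using Nat.le_induction with
    | base => simp
    | succ m hm ih =>
      have := abs_sub_le (ρ (m + 1)) (ρ m) (ρ n)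
      linarith [h m (hn.trans hm)]
  refine le_of_tendsto (hρ.sub_const (ρ n)).abs ?_
  filter_upwards [eventually_ge_atTop n] with m hm
  linarith [key m hm, hz m]

theorem one_div_pow_le_two_mul_sub (M n : ℕ) :
    (1 / ((n : ℝ) + 1)) ^ (M + 2) ≤
      2 * ((1 / ((n : ℝ) + 1)) ^ (M + 1) - (1 / (((n + 1 : ℕ) : ℝ) + 1)) ^ (M + 1)) := by
  set t : ℝ := 1 / ((n : ℝ) + 1) with ht
  set u : ℝ := 1 / (((n + 1 : ℕ) : ℝ) + 1) with hu
  have hu0 : 0 ≤ u := by positivity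
  have ht0 : 0 < t := by positivity
  have hut : u ≤ t := by
    apply one_div_le_one_div_of_le (by positivity)
    push_cast
    linarith
  have h1 : t * t ≤ 2 * (t - u) := by
    rw [ht, hu]
    push_cast
    have hn : (0 : ℝ) ≤ n := by positivity
    rw [div_sub_div _ _ (by positivity) (by positivity), div_mul_div_comm, mul_div_assoc',
      div_le_div_iff₀ (by positivity) (by positivity)]
    nlinarith [mul_nonneg hn hn, mul_nonneg hn (mul_nonneg hn hn)]
  have h2 : u ^ M ≤ t ^ M := pow_le_pow_left₀ hu0 hut M
  calc t ^ (M + 2) = t ^ M * (t * t) := by ring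
    _ ≤ t ^ M * (2 * (t - u)) := by gcongr
    _ ≤ 2 * (t ^ (M + 1) - u ^ (M + 1)) := by
      rw [pow_succ, pow_succ]
      nlinarith [mul_le_mul_of_nonneg_right h2 hu0]

theorem recurrenceDefect_one_div (δ : ℝ) (Q : ℝ → ℝ) (n : ℕ) :
    ((n : ℝ) + 1) ^ δ * recurrenceDefect δ Q (1 / ((n : ℝ) + 1)) =
      (((n + 1 : ℕ) : ℝ) + 1) ^ δ * Q (1 / (((n + 1 : ℕ) : ℝ) + 1)) -
        (1 + δ * (1 / ((n : ℝ) + 1))) * (((n : ℝ) + 1) ^ δ * Q (1 / ((n : ℝ) + 1))) := by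
  have h1 : 1 / ((n : ℝ) + 1) / (1 + 1 * (1 / ((n : ℝ) + 1))) = 1 / (((n + 1 : ℕ) : ℝ) + 1) := by
    push_cast
    field_simp
  have h2 : ((n : ℝ) + 1) ^ δ * (1 + 1 * (1 / ((n : ℝ) + 1))) ^ δ =
      (((n + 1 : ℕ) : ℝ) + 1) ^ δ := by
    rw [← Real.mul_rpow (by positivity) (by positivity)]
    congr 1
    push_cast
    field_simp
  rw [recurrenceDefect, shiftGerm, h1, ← h2]
  ring

theorem continuousAt_of_mem_powSpan {δ ε : ℝ} {Q : ℝ → ℝ} (hQ : Q ∈ powSpan δ ε) :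
    ContinuousAt Q 0 := by
  induction hQ using Submodule.span_induction with
  | mem x hx =>
    obtain ⟨s, -, rfl⟩ := hx
    exact ContinuousAt.rpow_const (by fun_prop) (by simp)
  | zero => exact continuousAt_const
  | add x y _ _ hx hy => exact hx.add hy
  | smul c x _ hx => exact hx.const_smul c

theorem exists_mem_powSpan_summable {δ : ℝ} (hδ : 0 < δ) :
    ∃ Q ∈ powSpan δ 1, Summable fun n : ℕ =>
      |cesaroA δ n - ((n : ℝ) + 1) ^ δ * Q (1 / ((n : ℝ) + 1))| := by
  set M := ⌈δ⌉₊ + 1 with hM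
  obtain ⟨Q, hQ, g, hQ0, hg, hdef⟩ := exists_mem_powSpan_recurrenceDefect_eq (δ := δ) M
  set L := Real.Gamma (δ + 1)
  have hL : 0 < L := Real.Gamma_pos_of_pos (by positivity)
  have ht : Tendsto (fun n : ℕ => 1 / ((n : ℝ) + 1)) atTop (𝓝 0) :=
    tendsto_one_div_add_atTop_nhds_zero_nat
  have hA := tendsto_add_one_rpow_div_cesaroA hδ
  set B : ℕ → ℝ := fun n => ((n : ℝ) + 1) ^ δ * Q (1 / ((n : ℝ) + 1)) with hB
  have hρ : Tendsto (fun n => B n / cesaroA δ n) atTop (𝓝 L) := by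
    have := hA.mul ((continuousAt_of_mem_powSpan hQ).tendsto.comp ht)
    rw [hQ0, mul_one] at this
    refine this.congr fun n => ?_
    simp only [hB, Function.comp]
    ring
  obtain ⟨N, hN⟩ : ∃ N : ℕ, ∀ n ≥ N,
      |B (n + 1) / cesaroA δ (n + 1) - B n / cesaroA δ n| ≤
        2 * ((|g 0| + 1) * (L + 1)) * (1 / ((n : ℝ) + 1)) ^ (M + 1) -
          2 * ((|g 0| + 1) * (L + 1)) * (1 / (((n + 1 : ℕ) : ℝ) + 1)) ^ (M + 1) := by
    refine eventually_atTop.1 ?_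
    have hg1 : ∀ᶠ t in 𝓝 0, |g t| < |g 0| + 1 :=
      hg.continuousAt.abs.eventually_lt_const (by linarith)
    have hA1 := (tendsto_add_atTop_iff_nat 1).2 hA |>.eventually_lt_const (lt_add_one L)
    filter_upwards [ht.eventually hdef, ht.eventually hg1, hA1] with n h1 h2 h3
    have hpos := cesaroA_pos hδ (n + 1)
    have hdiff : B (n + 1) / cesaroA δ (n + 1) - B n / cesaroA δ n =
        ((n : ℝ) + 1) ^ δ / cesaroA δ (n + 1) * ((1 / ((n : ℝ) + 1)) ^ (M + 2) *
          g (1 / ((n : ℝ) + 1))) := by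
      rw [← h1, div_mul_eq_mul_div, recurrenceDefect_one_div, sub_div, cesaroA_succ hδ n,
        mul_div_mul_left _ _ (by positivity)]
    have h4 : ((n : ℝ) + 1) ^ δ / cesaroA δ (n + 1) ≤ L + 1 := by
      refine le_trans ?_ h3.le
      gcongr
      linarith
    rw [hdiff, abs_mul, abs_mul, abs_of_nonneg (by positivity), abs_of_nonneg (by positivity)]
    calc _ ≤ (L + 1) * ((1 / ((n : ℝ) + 1)) ^ (M + 2) * (|g 0| + 1)) := by gcongr
      _ ≤ (L + 1) * (2 * ((1 / ((n : ℝ) + 1)) ^ (M + 1) -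
          (1 / (((n + 1 : ℕ) : ℝ) + 1)) ^ (M + 1)) * (|g 0| + 1)) := by
        gcongr
        exact one_div_pow_le_two_mul_sub M n
      _ = _ := by ring
  refine ⟨L⁻¹ • Q, Submodule.smul_mem _ _ hQ, ?_⟩
  have hsum : Summable fun n : ℕ => (1 / ((n : ℝ) + 1)) ^ 2 := by
    have := (summable_nat_add_iff 1).2 (Real.summable_one_div_nat_pow.2 one_lt_two)
    simpa using this
  refine summable_of_isBigO_nat hsum (.of_bound
    (2 / L * (2 * ((|g 0| + 1) * (L + 1))) * L⁻¹) ?_)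
  have hA2 := hA.eventually_const_lt (half_lt_self hL)
  filter_upwards [eventually_ge_atTop N, hA2] with n hn h1
  have h2 := abs_sub_le_of_tendsto_of_abs_sub_succ_le hρ (fun n => by positivity) hN hn
  have hpos := cesaroA_pos hδ n
  have h3 : cesaroA δ n ≤ 2 / L * ((n : ℝ) + 1) ^ δ := by
    rw [lt_div_iff₀ hpos] at h1
    rw [div_mul_eq_mul_div, le_div_iff₀ hL]
    linarith
  have h4 : cesaroA δ n - ((n : ℝ) + 1) ^ δ * (L⁻¹ • Q) (1 / ((n : ℝ) + 1)) =
      cesaroA δ n * (L - B n / cesaroA δ n) * L⁻¹ := by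
    simp only [hB, Pi.smul_apply, smul_eq_mul]
    field_simp
  have h5 : ((n : ℝ) + 1) ^ δ * (1 / ((n : ℝ) + 1)) ^ (M + 1) ≤ (1 / ((n : ℝ) + 1)) ^ 2 := by
    have : ((n : ℝ) + 1) ^ δ ≤ ((n : ℝ) + 1) ^ ⌈δ⌉₊ := by
      rw [← Real.rpow_natCast]
      exact Real.rpow_le_rpow_of_exponent_le (by linarith [n.cast_nonneg (α := ℝ)]) (Nat.le_ceil δ)
    calc _ ≤ ((n : ℝ) + 1) ^ ⌈δ⌉₊ * (1 / ((n : ℝ) + 1)) ^ (M + 1) := by gcongr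
      _ = _ := by
        rw [hM, add_assoc, pow_add, ← mul_assoc, ← mul_pow, mul_one_div_cancel (by positivity)]
        simp
  rw [Real.norm_eq_abs, abs_abs, Real.norm_of_nonneg (by positivity), h4, abs_mul, abs_mul,
    abs_of_pos hpos, abs_of_pos (inv_pos.2 hL)]
  calc _ ≤ 2 / L * ((n : ℝ) + 1) ^ δ *
        (2 * ((|g 0| + 1) * (L + 1)) * (1 / ((n : ℝ) + 1)) ^ (M + 1)) * L⁻¹ := by gcongr
    _ = 2 / L * (2 * ((|g 0| + 1) * (L + 1))) * L⁻¹ *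
        (((n : ℝ) + 1) ^ δ * (1 / ((n : ℝ) + 1)) ^ (M + 1)) := by ring
    _ ≤ _ := by gcongr

theorem rpow_mul_rieszMean (δ : ℝ) (a : ℕ → ℝ) (N : ℕ) {s : ℝ} (hs : s ∈ Ico (0 : ℝ) 1) :
    ((N : ℝ) + 1 - s) ^ δ * rieszMean δ a (N + 1 - s) =
      ∑ k ∈ Finset.range (N + 1), ((N : ℝ) + 1 - s - k) ^ δ * a k := by
  obtain ⟨h0, h1⟩ := hs
  have hceil : ⌈(N : ℝ) + 1 - s⌉₊ = N + 1 := by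
    rw [Nat.ceil_eq_iff (by omega)]
    constructor <;> push_cast <;> linarith
  have hN := N.cast_nonneg (α := ℝ)
  have hpos : 0 < (N : ℝ) + 1 - s := by linarith
  rw [rieszMean, hceil, Finset.mul_sum]
  refine Finset.sum_congr rfl fun k hk => ?_
  have hk' : (k : ℝ) ≤ N := by exact_mod_cast Nat.lt_succ_iff.1 (Finset.mem_range.1 hk)
  have hkR : (k : ℝ) < N + 1 - s := by linarith
  have hkR' : 0 ≤ 1 - (k : ℝ) / (N + 1 - s) := by
    rw [sub_nonneg, div_le_one hpos]
    exact hkR.le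
  rw [if_pos hkR, ← mul_assoc, ← Real.mul_rpow hpos.le hkR', mul_sub, mul_one,
    mul_div_cancel₀ _ hpos.ne']

theorem exists_abs_sum_le_of_mem_powSpan {δ : ℝ} (hδ : 0 < δ) {Q : ℝ → ℝ}
    (hQ : Q ∈ powSpan δ 1) :
    ∃ W ≥ 0, ∀ (a : ℕ → ℝ) (N : ℕ) (b : ℝ),
      (∀ s ∈ Ico (0 : ℝ) 1, |rieszMean δ a (N + 1 - s)| ≤ b) →
        |∑ k ∈ Finset.range (N + 1),
          (((N - k : ℕ) : ℝ) + 1) ^ δ * Q (1 / (((N - k : ℕ) : ℝ) + 1)) * a k| ≤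
            W * ((N : ℝ) + 1) ^ δ * b := by
  induction hQ using Submodule.span_induction with
  | mem x hx =>
    obtain ⟨s, hs, rfl⟩ := hx
    refine ⟨1, zero_le_one, fun a N b hb => ?_⟩
    have hN := N.cast_nonneg (α := ℝ)
    have hpos : 0 < (N : ℝ) + 1 - s := by linarith [hs.2]
    have hsum : ∑ k ∈ Finset.range (N + 1), (((N - k : ℕ) : ℝ) + 1) ^ δ *
        (1 - s * (1 / (((N - k : ℕ) : ℝ) + 1))) ^ δ * a k =
          ((N : ℝ) + 1 - s) ^ δ * rieszMean δ a (N + 1 - s) := by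
      rw [rpow_mul_rieszMean δ a N hs]
      refine Finset.sum_congr rfl fun k hk => ?_
      have hk' := Nat.lt_succ_iff.1 (Finset.mem_range.1 hk)
      have hNk := (N - k).cast_nonneg (α := ℝ)
      rw [← Real.mul_rpow (by positivity), mul_sub, mul_left_comm, mul_one_div_cancel (by positivity),
        Nat.cast_sub hk']
      · ring_nf
      · rw [mul_one_div, sub_nonneg, div_le_one (by positivity)]
        linarith [hs.2]
    have hb0 : 0 ≤ b := (abs_nonneg _).trans (hb s hs)
    rw [hsum, abs_mul, abs_of_nonneg (by positivity), one_mul]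
    gcongr
    · linarith [hs.1]
    · exact hb s hs
  | zero => exact ⟨0, le_rfl, fun a N b _ => by simp⟩
  | add x y _ _ hx hy =>
    obtain ⟨W, hW, hx⟩ := hx
    obtain ⟨W', hW', hy⟩ := hy
    refine ⟨W + W', add_nonneg hW hW', fun a N b hb => ?_⟩
    simp only [Pi.add_apply, mul_add, add_mul, Finset.sum_add_distrib]
    exact (abs_add_le _ _).trans (add_le_add (hx a N b hb) (hy a N b hb))
  | smul c x _ hx =>
    obtain ⟨W, hW, hx⟩ := hx
    refine ⟨|c| * W, by positivity, fun a N b hb => ?_⟩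
    simp only [Pi.smul_apply, smul_eq_mul, mul_left_comm _ c, mul_assoc c, ← Finset.mul_sum,
      abs_mul, mul_assoc |c|]
    gcongr
    simpa only [mul_assoc] using hx a N b hb

theorem exists_abs_cesaroMean_le {δ : ℝ} (hδ : 0 < δ) :
    ∃ C > 0, ∀ (a : ℕ → ℝ) (K : ℝ), (∀ k : ℕ, |a k| / ((k : ℝ) + 1) ^ δ ≤ K) →
      ∀ᶠ N : ℕ in atTop, ∀ b, (∀ s ∈ Ico (0 : ℝ) 1, |rieszMean δ a (N + 1 - s)| ≤ b) →
        |cesaroMean δ a N| ≤ C * b + C * K := by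
  obtain ⟨Q, hQ, hsum⟩ := exists_mem_powSpan_summable hδ
  obtain ⟨W, hW, hWb⟩ := exists_abs_sum_le_of_mem_powSpan hδ hQ
  set e : ℕ → ℝ := fun n => cesaroA δ n - ((n : ℝ) + 1) ^ δ * Q (1 / ((n : ℝ) + 1)) with he
  set E := ∑' n, |e n|
  have hE : 0 ≤ E := tsum_nonneg fun n => abs_nonneg _
  set L := Real.Gamma (δ + 1)
  have hL : 0 < L := Real.Gamma_pos_of_pos (by positivity)
  refine ⟨(L + 1) * (W + E + 1), by positivity, fun a K hK => ?_⟩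
  have hK0 : 0 ≤ K := le_trans (by positivity) (hK 0)
  have hA := (tendsto_add_one_rpow_div_cesaroA hδ).eventually_lt_const (lt_add_one L)
  filter_upwards [hA] with N hN b hb
  have hb0 : 0 ≤ b := (abs_nonneg _).trans (hb 0 (by simp))
  have hpos := cesaroA_pos hδ N
  have herr : |∑ k ∈ Finset.range (N + 1), e (N - k) * a k| ≤ E * ((N : ℝ) + 1) ^ δ * K := by
    calc _ ≤ ∑ k ∈ Finset.range (N + 1), |e (N - k)| * (((N : ℝ) + 1) ^ δ * K) := by
          refine (Finset.abs_sum_le_sum_abs _ _).trans (Finset.sum_le_sum fun k hk => ?_)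
          have hk' : (k : ℝ) ≤ N := by exact_mod_cast Nat.lt_succ_iff.1 (Finset.mem_range.1 hk)
          have := (div_le_iff₀ (by positivity)).1 (hK k)
          rw [abs_mul, mul_comm _ K]
          gcongr
          refine this.trans ?_
          gcongr
      _ = (∑ k ∈ Finset.range (N + 1), |e k|) * (((N : ℝ) + 1) ^ δ * K) := by
          rw [← Finset.sum_mul, ← Finset.sum_range_reflect (fun k => |e k|)]
          simp
      _ ≤ E * (((N : ℝ) + 1) ^ δ * K) := by
          gcongr
          exact hsum.sum_le_tsum _ fun n _ => abs_nonneg _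
      _ = _ := by ring
  have hsplit : ∑ k ∈ Finset.range (N + 1), cesaroA δ (N - k) * a k =
      ∑ k ∈ Finset.range (N + 1),
        (((N - k : ℕ) : ℝ) + 1) ^ δ * Q (1 / (((N - k : ℕ) : ℝ) + 1)) * a k +
      ∑ k ∈ Finset.range (N + 1), e (N - k) * a k := by
    rw [← Finset.sum_add_distrib]
    refine Finset.sum_congr rfl fun k _ => ?_
    simp only [he]
    ring
  rw [cesaroMean, hsplit, abs_mul, abs_of_pos (by positivity)]
  calc _ ≤ 1 / cesaroA δ N * (W * ((N : ℝ) + 1) ^ δ * b + E * ((N : ℝ) + 1) ^ δ * K) := by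
        gcongr
        exact (abs_add_le _ _).trans (add_le_add (hWb a N b hb) herr)
    _ = ((N : ℝ) + 1) ^ δ / cesaroA δ N * (W * b + E * K) := by ring
    _ ≤ (L + 1) * ((W + E + 1) * b + (W + E + 1) * K) := by
        gcongr <;> linarith
    _ = _ := by ring

theorem stmt_13 (δ : ℝ) (hδ : 0 < δ) :
    ∃ C > (0 : ℝ), ∀ a : ℕ → ℝ,
      Filter.limsup (fun N : ℕ => ENNReal.ofReal |cesaroMean δ a N|) Filter.atTop ≤
        ENNReal.ofReal C *
            Filter.limsup (fun R : ℝ => ENNReal.ofReal |rieszMean δ a R|) Filter.atTop +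
          ENNReal.ofReal C * ⨆ k : ℕ, ENNReal.ofReal (|a k| / ((k : ℝ) + 1) ^ δ) := by
  obtain ⟨C, hC, h⟩ := exists_abs_cesaroMean_le hδ
  refine ⟨C, hC, fun a => ?_⟩
  have hC0 : ENNReal.ofReal C ≠ 0 := by simpa using hC
  set K := ⨆ k : ℕ, ENNReal.ofReal (|a k| / ((k : ℝ) + 1) ^ δ)
  by_cases hK : K = ⊤
  · simp [hK, ENNReal.mul_top hC0]
  set l := Filter.limsup (fun R : ℝ => ENNReal.ofReal |rieszMean δ a R|) Filter.atTop
  by_cases hltop : l = ⊤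
  · simp [hltop, ENNReal.mul_top hC0]
  have hKa (k : ℕ) : |a k| / ((k : ℝ) + 1) ^ δ ≤ K.toReal :=
    (ENNReal.ofReal_le_iff_le_toReal hK).1
      (le_iSup (fun k : ℕ => ENNReal.ofReal (|a k| / ((k : ℝ) + 1) ^ δ)) k)
  have key (b : ENNReal) (hb : l < b) (hbtop : b ≠ ⊤) :
      Filter.limsup (fun N : ℕ => ENNReal.ofReal |cesaroMean δ a N|) Filter.atTop ≤
        ENNReal.ofReal C * b + ENNReal.ofReal C * K := by
    refine limsup_le_of_le (h := ?_)
    obtain ⟨R₀, hR₀⟩ := eventually_atTop.1 (eventually_lt_of_limsup_lt hb)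
    filter_upwards [h a K.toReal hKa, eventually_ge_atTop ⌈R₀⌉₊] with N hN hNR
    have := hN b.toReal fun s hs => (ENNReal.ofReal_le_iff_le_toReal hbtop).1
      (hR₀ _ (by linarith [Nat.ceil_le.1 hNR, hs.2])).le
    refine (ENNReal.ofReal_le_ofReal this).trans_eq ?_
    rw [ENNReal.ofReal_add (by positivity) (by positivity), ENNReal.ofReal_mul hC.le,
      ENNReal.ofReal_mul hC.le, ENNReal.ofReal_toReal hbtop, ENNReal.ofReal_toReal hK]
  have hcont : ContinuousAt (fun b => ENNReal.ofReal C * b + ENNReal.ofReal C * K) l :=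
    ((ENNReal.continuous_const_mul ENNReal.ofReal_ne_top).add continuous_const).continuousAt
  have : (𝓝[>] l).NeBot := nhdsGT_neBot_of_exists_gt ⟨⊤, lt_top_iff_ne_top.2 hltop⟩
  refine ge_of_tendsto (hcont.tendsto.mono_left (nhdsWithin_le_nhds (s := Ioi l))) ?_
  filter_upwards [self_mem_nhdsWithin, nhdsWithin_le_nhds (Iio_mem_nhds (lt_top_iff_ne_top.2 hltop))]
    with b hb hbtop
  exact key b hb (ne_of_lt hbtop)
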